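/- (Simon's theorem) Let A be a finite alphabet and let φ : A* → M be a surjective monoid homomorphism onto a finite monoid M. Then M is J-trivial if and only if there exists k ≥ 1 such that for all words w, w' ∈ A*, w ~_k w' implies φ(w) = φ(w'). -/

import Mathlib

/-- A monoid is `J`-trivial if equality of the two-sided ideals generated by
two elements implies equality of the elements. -/
def JTrivial (M : Type) [Monoid M] : Prop :=
  ∀ s t : M, {x : M | ∃ a b : M, a * s * b = x} = {x : M | ∃ a b : M, a * t * b = x} → s = t

/-- Two words have exactly the same subwords (scattered subsequences) of length
at most `k`. -/
def SameSubwords {A : Type} (k : ℕ) (w w' : List A) : Prop :=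
  ∀ v : List A, v.length ≤ k → (v.Sublist w ↔ v.Sublist w')

section Subwords

variable {A : Type} {k : ℕ}

theorem SameSubwords.symm {u v : List A} (h : SameSubwords k u v) : SameSubwords k v u :=
  fun r hr => (h r hr).symm

theorem SameSubwords.trans {u v w : List A} (h : SameSubwords k u v) (h' : SameSubwords k v w) :
    SameSubwords k u w :=
  fun r hr => (h r hr).trans (h' r hr)

theorem SameSubwords.of_sublist {u v : List A} (huv : u.Sublist v)
    (h : ∀ r : List A, r.length ≤ k → r.Sublist v → r.Sublist u) : SameSubwords k u v :=
  fun r hr => ⟨fun hu => hu.trans huv, h r hr⟩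

theorem SameSubwords.left_of_between {u v w : List A} (h : SameSubwords k u w)
    (huv : u.Sublist v) (hvw : v.Sublist w) : SameSubwords k u v :=
  .of_sublist huv fun r hr hv => (h r hr).2 (hv.trans hvw)

theorem SameSubwords.right_of_between {u v w : List A} (h : SameSubwords k u w)
    (huv : u.Sublist v) (hvw : v.Sublist w) : SameSubwords k v w :=
  (h.left_of_between huv hvw).symm.trans h

theorem SameSubwords.reverse {u v : List A} (h : SameSubwords k u v) :
    SameSubwords k u.reverse v.reverse := by
  intro r hr
  rw [← List.reverse_sublist, List.reverse_reverse, ← List.reverse_sublist (l₂ := v.reverse),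
    List.reverse_reverse]
  exact h _ (by simpa using hr)

/-- A word that becomes a subword of `x y` only after inserting the letter `b` between
`x` and `y` must use that letter. -/
theorem exists_eq_append_cons_of_sublist_insert {x y r : List A} {b : A}
    (h : r.Sublist (x ++ b :: y)) (hn : ¬ r.Sublist (x ++ y)) :
    ∃ r₁ r₂, r = r₁ ++ b :: r₂ ∧ r₁.Sublist x ∧ r₂.Sublist y := by
  obtain ⟨p, q, rfl, hp, hq⟩ := List.sublist_append_iff.1 h
  rcases List.sublist_cons_iff.1 hq with hq | ⟨q', rfl, hq'⟩
  · exact absurd (hp.append hq) hn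
  · exact ⟨p, q', rfl, hp, hq'⟩

theorem exists_not_sublist_insert {x y : List A} {b : A}
    (h : ¬ SameSubwords k (x ++ y) (x ++ b :: y)) :
    ∃ r₁ r₂ : List A, r₁.length + r₂.length + 1 ≤ k ∧ r₁.Sublist x ∧ r₂.Sublist y ∧
      ¬ (r₁ ++ b :: r₂).Sublist (x ++ y) := by
  by_contra! hc
  refine h (.of_sublist ((List.Sublist.refl x).append (List.sublist_cons_self b y)) ?_)
  intro r hr hs
  by_contra hn
  obtain ⟨r₁, r₂, rfl, h₁, h₂⟩ := exists_eq_append_cons_of_sublist_insert hs hn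
  exact hn (hc r₁ r₂ (by simp at hr; omega) h₁ h₂)

/-- If `s a` is not a subword of `x`, then what follows `s` in `r ≤ a y` can be found in `z`
as soon as short subwords of `x a y` are subwords of `x b z`. -/
theorem sublist_of_sublist_cons {x y z s r : List A} {a b : A} (hab : a ≠ b)
    (h : SameSubwords k (x ++ a :: y) (x ++ b :: z)) (hs : s.Sublist x)
    (hsx : ¬ (s ++ [a]).Sublist x) (hr : r.Sublist (a :: y)) (hk : s.length + r.length + 1 ≤ k) :
    r.Sublist z := by
  obtain ⟨t, ht, htr, hty⟩ : ∃ t : List A, t.length ≤ r.length ∧ r.Sublist (a :: t) ∧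
      t.Sublist y := by
    rcases List.sublist_cons_iff.1 hr with hr | ⟨t, rfl, ht⟩
    · exact ⟨r, le_rfl, List.sublist_cons_self _ _, hr⟩
    · exact ⟨t, by simp, List.Sublist.refl _, ht⟩
  have hsat : (s ++ a :: t).Sublist (x ++ b :: z) :=
    (h _ (by simp; omega)).1 (hs.append (hty.cons_cons a))
  refine htr.trans ?_
  obtain ⟨p, q, hpq, hp, hq⟩ := List.sublist_append_iff.1 hsat
  have hat : (a :: t).Sublist (b :: z) := by
    obtain ⟨e, he, he'⟩ | ⟨e, -, he⟩ := List.append_eq_append_iff.1 hpq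
    · cases e with
      | nil => simp at he'; exact he' ▸ hq
      | cons c e =>
        obtain ⟨rfl, -⟩ := List.cons.inj he'
        exact absurd (List.Sublist.trans (by simp [he]) hp) hsx
    · exact (List.sublist_append_right e _).trans (he ▸ hq)
  rcases List.sublist_cons_iff.1 hat with hat | ⟨_, heq, -⟩
  · exact hat
  · exact absurd (List.cons.inj heq).1 hab

theorem SameSubwords.insert_or_insert {x y z : List A} {a b : A} (hab : a ≠ b)
    (h : SameSubwords k (x ++ a :: y) (x ++ b :: z)) :
    SameSubwords k (x ++ a :: y) (x ++ b :: a :: y) ∨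
      SameSubwords k (x ++ b :: z) (x ++ a :: b :: z) := by
  by_contra! hc
  obtain ⟨r₁, r₂, hr, hr₁, hr₂, hrn⟩ := exists_not_sublist_insert hc.1
  obtain ⟨s₁, s₂, hs, hs₁, hs₂, hsn⟩ := exists_not_sublist_insert hc.2
  have hrx : ¬ (r₁ ++ [b]).Sublist x := fun hx => hrn (by simpa using hx.append hr₂)
  have hsx : ¬ (s₁ ++ [a]).Sublist x := fun hx => hsn (by simpa using hx.append hs₂)
  rcases (by omega : s₁.length + r₂.length + 1 ≤ k ∨ r₁.length + s₂.length + 1 ≤ k) with hk | hk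
  · have hz := sublist_of_sublist_cons hab h hs₁ hsx hr₂ hk
    exact hrn ((h _ (by simp; omega)).2 (hr₁.append (hz.cons_cons b)))
  · have hy := sublist_of_sublist_cons hab.symm h.symm hr₁ hrx hs₂ hk
    exact hsn ((h _ (by simp; omega)).1 (hs₁.append (hy.cons_cons a)))

theorem SameSubwords.exists_superword_append (x y z : List A)
    (h : SameSubwords k (x ++ y) (x ++ z)) :
    ∃ w, (x ++ y).Sublist w ∧ (x ++ z).Sublist w ∧ SameSubwords k (x ++ y) w := by
  match y, z with
  | [], z => exact ⟨x ++ z, by simp, .refl _, h⟩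
  | a :: y, [] => exact ⟨x ++ a :: y, .refl _, by simp, fun _ _ => .rfl⟩
  | a :: y, b :: z =>
    by_cases hab : a = b
    · subst hab
      obtain ⟨w, h₁, h₂, h₃⟩ := exists_superword_append (x ++ [a]) y z (by simpa using h)
      exact ⟨w, by simpa using h₁, by simpa using h₂, by simpa using h₃⟩
    · rcases h.insert_or_insert hab with hi | hi
      · obtain ⟨w, h₁, h₂, h₃⟩ := exists_superword_append (x ++ [b]) (a :: y) z
          (by simpa using hi.symm.trans h)
        simp only [List.append_assoc, List.singleton_append] at h₁ h₂ h₃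
        exact ⟨w, .trans (by simp) h₁, h₂, hi.trans h₃⟩
      · obtain ⟨w, h₁, h₂, h₃⟩ := exists_superword_append (x ++ [a]) y (b :: z)
          (by simpa using h.trans hi)
        simp only [List.append_assoc, List.singleton_append] at h₁ h₂ h₃
        exact ⟨w, h₁, .trans (by simp) h₂, h₃⟩
termination_by y.length + z.length

/-- Two `k`-equivalent words have a common superword in their `k`-equivalence class. -/
theorem SameSubwords.exists_superword {u v : List A} (h : SameSubwords k u v) :
    ∃ w, u.Sublist w ∧ v.Sublist w ∧ SameSubwords k u w :=
  exists_superword_append [] u v h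

/-- If inserting `a` between `x` and `y` preserves the subwords of length at most `2 * k`,
then appending it to `x` or prepending it to `y` preserves those of length at most `k`. -/
theorem SameSubwords.append_or_cons {x y : List A} {a : A}
    (h : SameSubwords (2 * k) (x ++ y) (x ++ a :: y)) :
    SameSubwords k x (x ++ [a]) ∨ SameSubwords k y (a :: y) := by
  by_contra! hc
  obtain ⟨hx, hy⟩ := hc
  rw [← List.append_nil x, List.append_assoc, List.nil_append] at hx
  obtain ⟨r, r', hr, hrx, hr', hrn⟩ := exists_not_sublist_insert hx
  obtain ⟨s', s, hs, hs', hsy, hsn⟩ := exists_not_sublist_insert (x := []) hy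
  obtain rfl := List.sublist_nil.1 hr'
  obtain rfl := List.sublist_nil.1 hs'
  simp only [List.append_nil, List.nil_append, List.length_nil] at *
  obtain ⟨p, q, hpq, hp, hq⟩ := List.sublist_append_iff.1
    ((h (r ++ a :: s) (by simp; omega)).2 (hrx.append (hsy.cons_cons a)))
  obtain ⟨e, he, he'⟩ | ⟨e, -, he⟩ := List.append_eq_append_iff.1 hpq
  · cases e with
    | nil => simp at he'; exact hsn (he' ▸ hq)
    | cons c e =>
      obtain ⟨rfl, -⟩ := List.cons.inj he'
      exact hrn (List.Sublist.trans (by simp [he]) hp)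
  · exact hsn ((List.sublist_append_right e _).trans (he ▸ hq))

theorem sublist_flatten_replicate {z : List A} :
    ∀ {k : ℕ} {v : List A}, v.length ≤ k → (∀ c ∈ v, c ∈ z) →
      v.Sublist (List.replicate k z).flatten
  | _, [], _, _ => List.nil_sublist _
  | k + 1, c :: v, hk, hc => by
    have hv : v.Sublist (List.replicate k z).flatten :=
      sublist_flatten_replicate (by simpa using hk) fun d hd => hc d (List.mem_cons_of_mem _ hd)
    simpa [List.replicate_succ] using (List.singleton_sublist.2 (hc c List.mem_cons_self)).append hv

/-- Words around `u` may be extended freely once they contain `k` copies of all the letters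
involved. -/
theorem sameSubwords_replicate_append (α β γ δ u : List A) :
    SameSubwords k
      ((List.replicate k (γ ++ α)).flatten ++ (u ++ (List.replicate k (β ++ δ)).flatten))
      ((α ++ (List.replicate k (γ ++ α)).flatten) ++
        (u ++ ((List.replicate k (β ++ δ)).flatten ++ β))) := by
  refine .of_sublist ((List.sublist_append_right _ _).append
    ((List.Sublist.refl _).append (List.sublist_append_left _ _))) ?_
  intro r hr h
  obtain ⟨p, q, rfl, hp, hq⟩ := List.sublist_append_iff.1 h
  obtain ⟨q, s, rfl, hq, hs⟩ := List.sublist_append_iff.1 hq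
  simp only [List.length_append] at hr
  refine (sublist_flatten_replicate (by omega) fun c hc => ?_).append
    (hq.append (sublist_flatten_replicate (by omega) fun c hc => ?_))
  · have := hp.subset hc
    simp at this ⊢
    tauto
  · have := hs.subset hc
    simp at this ⊢
    tauto

end Subwords

section JTrivial

variable {A M : Type} [Monoid M]

theorem JTrivial.eq_of_mul_eq (hM : JTrivial M) {s t a b c d : M}
    (hs : a * t * b = s) (ht : c * s * d = t) : s = t := by
  refine hM s t (Set.ext fun x => ⟨?_, ?_⟩)
  · rintro ⟨p, q, rfl⟩
    exact ⟨p * a, b * q, by simp only [← hs, mul_assoc]⟩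
  · rintro ⟨p, q, rfl⟩
    exact ⟨p * c, d * q, by simp only [← ht, mul_assoc]⟩

theorem JTrivial.mulOpposite (hM : JTrivial M) : JTrivial Mᵐᵒᵖ := by
  intro s t h
  obtain ⟨a, b, hab⟩ : s ∈ {x | ∃ a b, a * t * b = x} := h ▸ ⟨1, 1, by simp⟩
  obtain ⟨c, d, hcd⟩ : t ∈ {x | ∃ a b, a * s * b = x} := h ▸ ⟨1, 1, by simp⟩
  refine MulOpposite.unop_injective (hM.eq_of_mul_eq (a := b.unop) (b := a.unop)
    (c := d.unop) (d := c.unop) ?_ ?_)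
  · simp [← hab, mul_assoc]
  · simp [← hcd, mul_assoc]

open Classical in
/-- The letters of a word at which the product, started at `s`, changes its value. -/
noncomputable def changeLetters (g : A → M) : M → List A → List A
  | _, [] => []
  | s, a :: x => if s * g a = s then changeLetters g s x else a :: changeLetters g (s * g a) x

theorem changeLetters_sublist (g : A → M) (s : M) (x : List A) :
    (changeLetters g s x).Sublist x := by
  induction x generalizing s with
  | nil => simp [changeLetters]
  | cons a x ih =>
    rw [changeLetters]
    split_ifs
    · exact (ih s).cons a
    · exact (ih _).cons_cons a

theorem mul_ne_of_changeLetters_eq_cons (g : A → M) {s : M} {x l : List A} {c : A}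
    (h : changeLetters g s x = c :: l) : s * g c ≠ s := by
  induction x with
  | nil => simp [changeLetters] at h
  | cons a x ih =>
    rw [changeLetters] at h
    split_ifs at h with ha
    · exact ih h
    · exact (List.cons.inj h).1 ▸ ha

/-- If the last letter of `x a` changes the product, then the changing letters of `x a`
do not form a subword of `x`. -/
theorem not_changeLetters_sublist (g : A → M) {s : M} {x : List A} {a : A}
    (h : s * (x.map g).prod * g a ≠ s * (x.map g).prod) :
    ¬ (changeLetters g s (x ++ [a])).Sublist x := by
  induction x generalizing s with
  | nil => simp_all [changeLetters]
  | cons b x ih =>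
    rw [List.cons_append, changeLetters]
    simp only [List.map_cons, List.prod_cons, ← mul_assoc] at h
    split_ifs with hb
    · rw [hb] at h
      intro hsub
      rcases List.sublist_cons_iff.1 hsub with hx | ⟨l, hl, -⟩
      · exact ih h hx
      · exact mul_ne_of_changeLetters_eq_cons g hl hb
    · rw [List.cons_sublist_cons]
      exact ih h

theorem JTrivial.length_changeLetters_le [Finite M] (hM : JTrivial M) (g : A → M) (s : M)
    (x : List A) : (changeLetters g s x).length ≤ (Set.range (s * ·)).ncard := by
  induction x generalizing s with
  | nil => simp [changeLetters]
  | cons a x ih =>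
    rw [changeLetters]
    split_ifs with ha
    · exact ih s
    · refine (Nat.succ_le_succ (ih _)).trans (Set.ncard_lt_ncard ⟨?_, fun hss => ha ?_⟩)
      · rintro _ ⟨m, rfl⟩
        exact ⟨g a * m, by simp [mul_assoc]⟩
      · obtain ⟨m, hm⟩ := hss ⟨1, mul_one s⟩
        exact hM.eq_of_mul_eq (a := 1) (b := g a) (c := 1) (d := m) (by simp) (by simpa using hm)

theorem JTrivial.prod_append_singleton [Finite M] (hM : JTrivial M) (g : A → M) {x : List A} {a : A}
    (h : SameSubwords (Nat.card M) x (x ++ [a])) :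
    ((x ++ [a]).map g).prod = (x.map g).prod := by
  by_contra hne
  refine not_changeLetters_sublist g (s := 1) (by simpa using hne)
    ((h _ ?_).2 (changeLetters_sublist g 1 _))
  exact (hM.length_changeLetters_le g 1 _).trans (Set.ncard_le_card _)

theorem op_prod_map (g : A → M) (y : List A) :
    MulOpposite.op (y.map g).prod = (y.reverse.map (MulOpposite.op ∘ g)).prod := by
  rw [MulOpposite.op_list_prod, List.map_reverse, List.map_map]

theorem JTrivial.prod_cons [Finite M] (hM : JTrivial M) (g : A → M) {y : List A} {a : A}
    (h : SameSubwords (Nat.card M) y (a :: y)) :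
    ((a :: y).map g).prod = (y.map g).prod := by
  have : Finite Mᵐᵒᵖ := .of_equiv M MulOpposite.opEquiv
  apply MulOpposite.op_injective
  rw [op_prod_map, op_prod_map, List.reverse_cons]
  refine hM.mulOpposite.prod_append_singleton _ ?_
  have hcard : Nat.card Mᵐᵒᵖ = Nat.card M := Nat.card_congr MulOpposite.opEquiv.symm
  simpa [hcard] using h.reverse

theorem JTrivial.prod_insert [Finite M] (hM : JTrivial M) (g : A → M) {x y : List A} {a : A}
    (h : SameSubwords (2 * Nat.card M) (x ++ y) (x ++ a :: y)) :
    ((x ++ a :: y).map g).prod = ((x ++ y).map g).prod := by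
  rcases h.append_or_cons with h | h
  · have := hM.prod_append_singleton g h
    simp only [List.map_append, List.map_cons, List.map_nil, List.prod_append, List.prod_cons,
      List.prod_nil, mul_one] at this ⊢
    rw [← mul_assoc, this]
  · rw [List.map_append, List.prod_append, hM.prod_cons g h, List.map_append, List.prod_append]

theorem JTrivial.prod_eq_of_sublist [Finite M] (hM : JTrivial M) (g : A → M) {u w : List A}
    (hs : u.Sublist w) (p : List A) (h : SameSubwords (2 * Nat.card M) (p ++ u) (p ++ w)) :
    ((p ++ u).map g).prod = ((p ++ w).map g).prod := by
  induction hs generalizing p with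
  | slnil => rfl
  | @cons u w a hs ih =>
    have h₁ := (List.Sublist.refl p).append hs
    have h₂ := (List.Sublist.refl p).append (List.sublist_cons_self a w)
    rw [ih p (h.left_of_between h₁ h₂), hM.prod_insert g (h.right_of_between h₁ h₂)]
  | @cons_cons u w a hs ih => simpa using ih (p ++ [a]) (by simpa using h)

theorem JTrivial.prod_eq_of_sameSubwords [Finite M] (hM : JTrivial M) (g : A → M) {u v : List A}
    (h : SameSubwords (2 * Nat.card M) u v) : (u.map g).prod = (v.map g).prod := by
  obtain ⟨w, hu, hv, huw⟩ := h.exists_superword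
  exact (hM.prod_eq_of_sublist g hu [] huw).trans
    (hM.prod_eq_of_sublist g hv [] (h.symm.trans huw)).symm

theorem jTrivial_of_prod_eq {g : A → M} (hg : ∀ m, ∃ u : List A, (u.map g).prod = m) (k : ℕ)
    (h : ∀ u v : List A, SameSubwords k u v → (u.map g).prod = (v.map g).prod) : JTrivial M := by
  intro s t hst
  obtain ⟨a, b, hab⟩ : s ∈ {x | ∃ a b, a * t * b = x} := hst ▸ ⟨1, 1, by simp⟩
  obtain ⟨c, d, hcd⟩ : t ∈ {x | ∃ a b, a * s * b = x} := hst ▸ ⟨1, 1, by simp⟩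
  obtain ⟨α, rfl⟩ := hg a
  obtain ⟨β, rfl⟩ := hg b
  obtain ⟨γ, rfl⟩ := hg c
  obtain ⟨δ, rfl⟩ := hg d
  obtain ⟨u, rfl⟩ := hg t
  have hpow (z : List A) (n : ℕ) :
      ((List.replicate n z).flatten.map g).prod = (z.map g).prod ^ n := by
    simp
  have hfix (n : ℕ) : ((γ ++ α).map g).prod ^ n * (u.map g).prod * ((β ++ δ).map g).prod ^ n =
      (u.map g).prod := by
    induction n with
    | zero => simp
    | succ n ih =>
      calc _ = ((γ ++ α).map g).prod ^ n *
            (((γ ++ α).map g).prod * (u.map g).prod * ((β ++ δ).map g).prod) *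
              ((β ++ δ).map g).prod ^ n := by
            rw [pow_succ, pow_succ']; simp only [mul_assoc]
        _ = _ := by
            rw [show ((γ ++ α).map g).prod * (u.map g).prod * ((β ++ δ).map g).prod =
              (u.map g).prod by rw [← hab] at hcd; simpa [mul_assoc] using hcd, ih]
  have key := h _ _ (sameSubwords_replicate_append (k := k) α β γ δ u)
  rw [List.map_append, List.map_append, List.prod_append, List.prod_append, hpow, hpow,
    ← mul_assoc, hfix] at key
  rw [key, ← hab]
  conv_lhs => rw [← hfix k]
  simp only [List.map_append, List.prod_append, hpow, mul_assoc]

end JTrivial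

/-- Simon's theorem: a finite monoid `M`, surjective image of `A*` under `φ`, is
`J`-trivial iff there is `k ≥ 1` such that `φ` identifies all `~_k`-equivalent words. -/
theorem simon (A : Type) [Fintype A] (M : Type) [Monoid M] [Fintype M]
    (φ : FreeMonoid A →* M) (hφ : Function.Surjective φ) :
    JTrivial M ↔ ∃ k : ℕ, 1 ≤ k ∧ ∀ w w' : FreeMonoid A,
      SameSubwords k (FreeMonoid.toList w) (FreeMonoid.toList w') → φ w = φ w' := by
  have hprod (w : FreeMonoid A) : φ w = (w.toList.map (φ ∘ FreeMonoid.of)).prod := by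
    rw [← FreeMonoid.lift_apply, ← FreeMonoid.lift_restrict φ]
    rfl
  constructor
  · intro hM
    refine ⟨2 * Nat.card M, by have := Nat.card_pos (α := M); omega, fun w w' h => ?_⟩
    rw [hprod, hprod]
    exact hM.prod_eq_of_sameSubwords _ h
  · rintro ⟨k, -, h⟩
    refine jTrivial_of_prod_eq (g := φ ∘ FreeMonoid.of) (fun m => ?_) k fun u v huv => ?_
    · obtain ⟨w, rfl⟩ := hφ m
      exact ⟨w.toList, (hprod w).symm⟩
    · simpa [hprod] using h (FreeMonoid.ofList u) (FreeMonoid.ofList v) huv
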